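/- There exist universal constants C > 0 and K > 0 such that if n ≥ C·(s⋆·log p)^{3/2} and p ≥ C, then for any θ₀ ∈ ℝ^p, P(λ_max(V_{n,S}) ≥ K·exp(3·‖θ₀‖₂²)·n for some S ∈ 𝒮_{s⋆}) ≤ 1/n + exp(−n/24) + 6·p^{−s⋆}, where V_{n,S} = ∑_{i=1}^n exp(X_iᵀθ₀)·X_{i,S}X_{i,S}ᵀ. -/

import Mathlib

open MeasureTheory ProbabilityTheory Matrix Real

/-- The law of an `n × p` matrix with i.i.d. standard normal entries. -/
noncomputable def gaussMat (n p : ℕ) : Measure (Fin n → Fin p → ℝ) :=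
  Measure.pi fun _ : Fin n => Measure.pi fun _ : Fin p => gaussianReal 0 1

/-- Largest eigenvalue (Rayleigh quotient supremum over unit vectors). -/
noncomputable def lamMax {m : Type*} [Fintype m] (A : Matrix m m ℝ) : ℝ :=
  sSup {r : ℝ | ∃ u : m → ℝ, (∑ i, u i ^ 2) = 1 ∧ r = u ⬝ᵥ A.mulVec u}

/-- Weighted Gram matrix `∑ᵢ wᵢ · X_{i,S} X_{i,S}ᵀ`. -/
noncomputable def gramW {n p : ℕ} (S : Finset (Fin p)) (w : Fin n → ℝ)
    (x : Fin n → Fin p → ℝ) : Matrix S S ℝ :=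
  Matrix.of fun j k => ∑ i, w i * x i j.1 * x i k.1

theorem map_dotProduct_pi_gaussianReal {ι : Type*} [Fintype ι] (v : ι → ℝ) :
    (Measure.pi fun _ : ι => gaussianReal 0 1).map (fun x => ∑ j, x j * v j) =
      gaussianReal 0 (∑ j, v j ^ 2).toNNReal := by
  apply Measure.ext_of_charFun
  ext t
  rw [charFun_apply_real, integral_map (Measurable.aemeasurable (by fun_prop)) (by fun_prop),
    charFun_gaussianReal]
  have h : ∀ x : ι → ℝ, Complex.exp (t * ((∑ j, x j * v j : ℝ) : ℂ) * Complex.I) =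
      ∏ j, Complex.exp ((t * v j : ℝ) * (x j : ℂ) * Complex.I) := by
    intro x
    rw [← Complex.exp_sum]
    congr 1
    push_cast
    rw [Finset.mul_sum, Finset.sum_mul]
    exact Finset.sum_congr rfl fun j _ => by ring
  simp_rw [h]
  rw [integral_fintype_prod_eq_prod
    (f := fun j (y : ℝ) => Complex.exp ((t * v j : ℝ) * (y : ℂ) * Complex.I))]
  simp_rw [← charFun_apply_real, charFun_gaussianReal]
  rw [← Complex.exp_sum]
  congr 1
  rw [Real.coe_toNNReal _ (Finset.sum_nonneg fun j _ => sq_nonneg _)]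
  push_cast
  simp [mul_pow, mul_comm, Finset.mul_sum, Finset.sum_div]

theorem integral_exp_sq_div_four_gaussianReal :
    Integrable (fun y => exp (y ^ 2 / 4)) (gaussianReal 0 1) ∧
      ∫ y, exp (y ^ 2 / 4) ∂gaussianReal 0 1 ≤ 2 := by
  have h : ∀ y : ℝ, gaussianPDFReal 0 1 y • exp (y ^ 2 / 4) =
      (√(2 * π))⁻¹ * exp (-(1 / 4) * y ^ 2) := by
    intro y
    simp only [gaussianPDFReal, smul_eq_mul, NNReal.coe_one, mul_one, sub_zero, mul_assoc,
      ← Real.exp_add]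
    ring_nf
  constructor
  · rw [gaussianReal_of_var_ne_zero _ one_ne_zero, gaussianPDF_def,
      integrable_withDensity_iff_integrable_smul' (by fun_prop) (by simp)]
    simp only [ENNReal.toReal_ofReal (gaussianPDFReal_nonneg 0 1 _), h]
    exact (integrable_exp_neg_mul_sq (by norm_num)).const_mul _
  · rw [integral_gaussianReal_eq_integral_smul one_ne_zero]
    simp_rw [h]
    rw [integral_const_mul, integral_gaussian, inv_mul_le_iff₀ (by positivity)]
    rw [← Real.sqrt_sq (show (0 : ℝ) ≤ 2 by norm_num), ← Real.sqrt_mul (by positivity)]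
    apply Real.sqrt_le_sqrt
    have := Real.pi_pos
    norm_num
    linarith

theorem integral_exp_sq_div_four_le {s : NNReal} (hs : s ≤ 1) :
    Integrable (fun y => exp (y ^ 2 / 4)) (gaussianReal 0 s) ∧
      ∫ y, exp (y ^ 2 / 4) ∂gaussianReal 0 s ≤ 2 := by
  have hm : gaussianReal 0 s = (gaussianReal 0 1).map (fun y => √s * y) := by
    rw [gaussianReal_map_const_mul]
    congr 1
    · simp
    · ext; simp
  obtain ⟨hi, hle⟩ := integral_exp_sq_div_four_gaussianReal
  have hb : ∀ y : ℝ, exp ((√s * y) ^ 2 / 4) ≤ exp (y ^ 2 / 4) := by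
    intro y
    apply Real.exp_le_exp.2
    rw [mul_pow, Real.sq_sqrt s.coe_nonneg]
    have : (s : ℝ) ≤ 1 := hs
    nlinarith [sq_nonneg y]
  have hi' : Integrable (fun y => exp ((√s * y) ^ 2 / 4)) (gaussianReal 0 1) :=
    hi.mono' (by fun_prop) (.of_forall fun y => by
      rw [Real.norm_of_nonneg (exp_pos _).le]; exact hb y)
  rw [hm]
  constructor
  · rw [integrable_map_measure (by fun_prop) (by fun_prop)]
    exact hi'
  · rw [integral_map (by fun_prop) (by fun_prop)]
    exact (integral_mono hi' hi hb).trans hle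

theorem abs_pow_three_le_exp (y : ℝ) : |y| ^ 3 ≤ 128 * exp (y ^ 2 / 8) := by
  have h := Real.quadratic_le_exp_of_nonneg (show 0 ≤ y ^ 2 / 8 by positivity)
  have h2 : y ^ 2 = |y| ^ 2 := (sq_abs y).symm
  rw [h2] at h ⊢
  nlinarith [sq_nonneg (|y| ^ 2 - |y|), abs_nonneg y, sq_nonneg (|y|), sq_nonneg (|y| - 1)]

theorem measureReal_le_abs_gaussianReal {s : NNReal} (hs : s ≤ 1) {M : ℝ} (hM : 0 ≤ M) :
    (gaussianReal 0 s).real {y | M ≤ |y|} ≤ 2 * exp (-(M ^ 2 / 4)) := by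
  obtain ⟨hi, hle⟩ := integral_exp_sq_div_four_le hs
  have h := mul_meas_ge_le_integral_of_nonneg (.of_forall fun y => (exp_pos _).le) hi
    (exp (M ^ 2 / 4))
  have hsub : {y : ℝ | M ≤ |y|} ⊆ {y | exp (M ^ 2 / 4) ≤ exp (y ^ 2 / 4)} := by
    intro y (hy : M ≤ |y|)
    have : M ^ 2 ≤ y ^ 2 := sq_le_sq' (by linarith [abs_nonneg y]) hy |>.trans_eq (sq_abs y)
    exact Real.exp_le_exp.2 (by linarith)
  have h' := measureReal_mono (μ := gaussianReal 0 s) hsub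
  rw [Real.exp_neg, ← div_eq_mul_inv, le_div_iff₀ (exp_pos _)]
  nlinarith [exp_pos (M ^ 2 / 4)]

/-- The cube of the absolute value, cut off above level `M`. -/
noncomputable def cutCube (M y : ℝ) : ℝ := if |y| ≤ M then |y| ^ 3 else 0

theorem measurable_cutCube (M : ℝ) : Measurable (cutCube M) :=
  Measurable.ite (measurableSet_le (by fun_prop) (by fun_prop)) (by fun_prop) (by fun_prop)

theorem exp_mul_cutCube_le {l M : ℝ} (hl : 0 ≤ l) (hlM : l * M ≤ 1 / 8) (y : ℝ) :
    exp (l * cutCube M y) ≤ 1 + 128 * l * exp (y ^ 2 / 4) := by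
  unfold cutCube
  split_ifs with h
  · have hx : l * |y| ^ 3 ≤ y ^ 2 / 8 := by
      rw [← sq_abs y]
      nlinarith [mul_le_mul_of_nonneg_left h hl, sq_nonneg (|y|)]
    have hx0 : 0 ≤ l * |y| ^ 3 := by positivity
    have h1 : exp (l * |y| ^ 3) ≤ 1 + l * |y| ^ 3 * exp (l * |y| ^ 3) := by
      have := Real.add_one_le_exp (-(l * |y| ^ 3))
      have h3 := mul_le_mul_of_nonneg_right this (exp_pos (l * |y| ^ 3)).le
      rw [← Real.exp_add, neg_add_cancel, Real.exp_zero] at h3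
      linarith
    have h4 : exp (y ^ 2 / 4) = exp (y ^ 2 / 8) * exp (y ^ 2 / 8) := by
      rw [← Real.exp_add]; ring_nf
    rw [h4]
    have h5 : l * |y| ^ 3 * exp (l * |y| ^ 3) ≤
        l * (128 * exp (y ^ 2 / 8)) * exp (y ^ 2 / 8) := by
      gcongr
      exact abs_pow_three_le_exp y
    linarith
  · have : 0 ≤ 128 * l * exp (y ^ 2 / 4) := by positivity
    simpa using this

theorem integrable_exp_mul_cutCube {s : NNReal} (hs : s ≤ 1) {l M : ℝ} (hl : 0 ≤ l)
    (hlM : l * M ≤ 1 / 8) :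
    Integrable (fun y => exp (l * cutCube M y)) (gaussianReal 0 s) := by
  have hm := measurable_cutCube M
  refine ((integrable_const 1).add ((integral_exp_sq_div_four_le hs).1.const_mul (128 * l))).mono'
    (by fun_prop) (.of_forall fun y => ?_)
  rw [Real.norm_of_nonneg (exp_pos _).le]
  exact exp_mul_cutCube_le hl hlM y

theorem mgf_cutCube_le {s : NNReal} (hs : s ≤ 1) {l M : ℝ} (hl : 0 ≤ l)
    (hlM : l * M ≤ 1 / 8) :
    mgf (cutCube M) (gaussianReal 0 s) l ≤ exp (256 * l) := by
  obtain ⟨hi, hle⟩ := integral_exp_sq_div_four_le hs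
  have h := integral_mono (integrable_exp_mul_cutCube hs hl hlM)
    ((integrable_const 1).add (hi.const_mul (128 * l))) (exp_mul_cutCube_le hl hlM)
  simp only [Pi.add_apply] at h
  rw [integral_add (integrable_const 1) (hi.const_mul _), integral_const_mul,
    integral_const] at h
  have := Real.add_one_le_exp (256 * l)
  simp only [mgf, probReal_univ, smul_eq_mul, mul_one] at h ⊢
  nlinarith

theorem measureReal_le_sum_cutCube {n : ℕ} {s : NNReal} (hs : s ≤ 1) {l M : ℝ} (hl : 0 ≤ l)
    (hlM : l * M ≤ 1 / 8) (t : ℝ) :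
    (Measure.pi fun _ : Fin n => gaussianReal 0 s).real {y | t ≤ ∑ i, cutCube M (y i)} ≤
      exp (256 * l * n - l * t) := by
  have hm := measurable_cutCube M
  have hind : iIndepFun (fun (i : Fin n) (y : Fin n → ℝ) => cutCube M (y i))
      (Measure.pi fun _ : Fin n => gaussianReal 0 s) :=
    iIndepFun_pi fun _ => hm.aemeasurable
  have hmeas : ∀ i : Fin n, Measurable fun y : Fin n → ℝ => cutCube M (y i) := fun i => by
    fun_prop
  have hmp := fun i => measurePreserving_eval (fun _ : Fin n => gaussianReal 0 s) i
  have hint := hind.integrable_exp_mul_sum hmeas (s := Finset.univ) (t := l) fun i _ =>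
    (hmp i).integrable_comp_of_integrable (integrable_exp_mul_cutCube hs hl hlM)
  have h := measure_ge_le_exp_mul_mgf t hl hint
  rw [hind.mgf_sum hmeas] at h
  have hmgf : ∀ i : Fin n, mgf (fun y : Fin n → ℝ => cutCube M (y i))
      (Measure.pi fun _ : Fin n => gaussianReal 0 s) l ≤ exp (256 * l) := fun i => by
    refine le_trans (le_of_eq ?_) (mgf_cutCube_le hs hl hlM)
    exact integral_comp_eval (μ := fun _ : Fin n => gaussianReal 0 s)
      (f := fun y => exp (l * cutCube M y)) (by fun_prop)
  have hprod := Finset.prod_le_prod (s := Finset.univ) (fun i _ => mgf_nonneg)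
    (fun i _ => hmgf i)
  simp only [Finset.sum_apply] at h
  refine h.trans ((mul_le_mul_of_nonneg_left hprod (exp_pos _).le).trans_eq ?_)
  rw [Finset.prod_const, Finset.card_univ, Fintype.card_fin, ← Real.exp_nat_mul, ← Real.exp_add]
  ring_nf

theorem measureReal_le_sum_abs_pow_three {n : ℕ} {s : NNReal} (hs : s ≤ 1) {m : ℝ} (hm : 0 < m)
    (hmn : m ^ 3 = n) :
    (Measure.pi fun _ : Fin n => gaussianReal 0 s).real {y | 288 * (n : ℝ) ≤ ∑ i, |y i| ^ 3} ≤
      3 * exp (-m ^ 2) := by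
  set μ := Measure.pi fun _ : Fin n => gaussianReal 0 s with hμ
  have hsub : {y : Fin n → ℝ | 288 * (n : ℝ) ≤ ∑ i, |y i| ^ 3} ⊆
      {y | 288 * (n : ℝ) ≤ ∑ i, cutCube (4 * m) (y i)} ∪
        ⋃ i ∈ (Finset.univ : Finset (Fin n)), {y | 4 * m ≤ |y i|} := by
    intro y hy
    by_cases h : ∃ i, 4 * m ≤ |y i|
    · right
      simpa using h
    · left
      push Not at h
      simp only [Set.mem_ofPred_eq] at hy ⊢
      simpa [cutCube, (h _).le] using hy
  have h1 := measureReal_le_sum_cutCube (n := n) hs (l := 1 / (32 * m)) (M := 4 * m)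
    (by positivity) (by field_simp; norm_num) (288 * n)
  have h2 : ∀ i : Fin n, μ.real {y | 4 * m ≤ |y i|} ≤ 2 * exp (-(4 * m ^ 2)) := fun i => by
    have h := measureReal_le_abs_gaussianReal hs (M := 4 * m) (by positivity)
    rw [← (measurePreserving_eval (fun _ : Fin n => gaussianReal 0 s) i).measureReal_preimage
      (measurableSet_le (by fun_prop) (by fun_prop)).nullMeasurableSet] at h
    refine h.trans_eq ?_
    ring_nf
  have h3 := (measureReal_mono hsub (μ := μ)).trans (measureReal_union_le _ _)
  have h4 := (measureReal_biUnion_finset_le (μ := μ) Finset.univ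
    fun i : Fin n => {y : Fin n → ℝ | 4 * m ≤ |y i|}).trans (Finset.sum_le_sum fun i _ => h2 i)
  rw [Finset.sum_const, Finset.card_univ, Fintype.card_fin, nsmul_eq_mul] at h4
  have h5 : 256 * (1 / (32 * m)) * n - 1 / (32 * m) * (288 * n) = -m ^ 2 := by
    rw [← hmn]; field_simp; ring
  rw [h5] at h1
  have h6 : (n : ℝ) ≤ exp (3 * m ^ 2) := by
    have : m ≤ exp (m ^ 2) := by nlinarith [Real.add_one_le_exp (m ^ 2), sq_nonneg (m - 1)]
    rw [← hmn, show 3 * m ^ 2 = (3 : ℕ) * m ^ 2 by norm_num, Real.exp_nat_mul]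
    gcongr
  have h7 : (n : ℝ) * (2 * exp (-(4 * m ^ 2))) ≤ 2 * exp (-m ^ 2) := by
    rw [show -m ^ 2 = 3 * m ^ 2 + -(4 * m ^ 2) by ring, Real.exp_add]
    nlinarith [exp_pos (-(4 * m ^ 2))]
  linarith

theorem measure_le_sum_exp_three_mul {n : ℕ} (hn : 1 ≤ n) (s : NNReal) :
    (Measure.pi fun _ : Fin n => gaussianReal 0 s)
        {y | 2 * n * exp (9 * s) ≤ ∑ i, exp (3 * y i)} ≤ ENNReal.ofReal (1 / n) := by
  have hint : ∀ t : ℝ, ∫ y, exp (t * y) ∂gaussianReal 0 s = exp (s * t ^ 2 / 2) := fun t => by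
    have := congrFun (mgf_id_gaussianReal (μ := 0) (v := s)) t
    simpa [mgf] using this
  have hL : MemLp (fun y => exp (3 * y)) 2 (gaussianReal 0 s) := by
    rw [memLp_two_iff_integrable_sq (by fun_prop)]
    refine (integrable_exp_mul_gaussianReal (μ := 0) (v := s) 6).congr (.of_forall fun y => ?_)
    simp only [← Real.exp_nat_mul]
    ring_nf
  have hvar : Var[fun y => exp (3 * y); gaussianReal 0 s] ≤ exp (18 * s) := by
    refine (variance_le_expectation_sq (by fun_prop)).trans (le_of_eq ?_)
    rw [show (18 : ℝ) * s = s * 6 ^ 2 / 2 by ring, ← hint 6]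
    congr 1 with y
    simp only [Pi.pow_apply, ← Real.exp_nat_mul]
    ring_nf
  have hmp := fun i => measurePreserving_eval (fun _ : Fin n => gaussianReal 0 s) i
  have hL' : ∀ i : Fin n, MemLp (fun y : Fin n → ℝ => exp (3 * y i)) 2
      (Measure.pi fun _ : Fin n => gaussianReal 0 s) := fun i =>
    hL.comp_measurePreserving (hmp i)
  have hE : ∫ y, ∑ i, exp (3 * y i) ∂(Measure.pi fun _ : Fin n => gaussianReal 0 s) =
      n * exp (s * 3 ^ 2 / 2) := by
    rw [integral_finsetSum _ fun i _ => (hL' i).integrable (by norm_num)]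
    have : ∀ i : Fin n, ∫ y : Fin n → ℝ, exp (3 * y i)
        ∂(Measure.pi fun _ : Fin n => gaussianReal 0 s) = exp (s * 3 ^ 2 / 2) := fun i => by
      rw [← hint 3]
      exact integral_comp_eval (μ := fun _ : Fin n => gaussianReal 0 s)
        (f := fun y => exp (3 * y)) (by fun_prop)
    simp [this]
  have hV := variance_sum_pi (μ := fun _ : Fin n => gaussianReal 0 s)
    (X := fun _ y => exp (3 * y)) (fun _ => hL)
  have hsum : (∑ i : Fin n, fun y : Fin n → ℝ => exp (3 * y i)) =
      fun y => ∑ i, exp (3 * y i) := by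
    ext y; simp
  rw [hsum] at hV
  have hn0 : (0 : ℝ) < n := by exact_mod_cast hn
  have h := meas_ge_le_variance_div_sq (memLp_finsetSum Finset.univ fun i _ => hL' i)
    (c := n * exp (9 * s)) (by positivity)
  rw [hV, hE] at h
  refine (measure_mono ?_).trans (h.trans (ENNReal.ofReal_le_ofReal ?_))
  · intro y hy
    simp only [Set.mem_ofPred_eq] at hy ⊢
    refine le_trans ?_ (le_abs_self _)
    have : exp ((s : ℝ) * 3 ^ 2 / 2) ≤ exp (9 * s) :=
      Real.exp_le_exp.2 (by nlinarith [s.coe_nonneg])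
    nlinarith
  · rw [Finset.sum_const, Finset.card_univ, Fintype.card_fin, nsmul_eq_mul, mul_pow,
      ← Real.exp_nat_mul, div_le_div_iff₀ (by positivity) hn0]
    have : exp ((2 : ℕ) * (9 * (s : ℝ))) = exp (18 * s) := by push_cast; ring_nf
    rw [this]
    nlinarith [mul_le_mul_of_nonneg_left hvar (sq_nonneg (n : ℝ))]

theorem dotProduct_gramW_mulVec {n p : ℕ} (S : Finset (Fin p)) (w : Fin n → ℝ)
    (x : Fin n → Fin p → ℝ) (u : S → ℝ) :
    u ⬝ᵥ (gramW S w x).mulVec u = ∑ i, w i * (∑ j : S, x i j * u j) ^ 2 := by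
  simp only [dotProduct, Matrix.mulVec, gramW, Matrix.of_apply, Finset.sum_mul, Finset.mul_sum,
    sq]
  rw [Finset.sum_congr rfl fun j _ => Finset.sum_comm, Finset.sum_comm]
  refine Finset.sum_congr rfl fun i _ => ?_
  rw [Finset.sum_comm]
  exact Finset.sum_congr rfl fun j _ => Finset.sum_congr rfl fun k _ => by ring

theorem bddAbove_rayleigh {m : Type*} [Fintype m] (A : Matrix m m ℝ) :
    BddAbove {r : ℝ | ∃ u : m → ℝ, (∑ i, u i ^ 2) = 1 ∧ r = u ⬝ᵥ A.mulVec u} := by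
  refine ⟨∑ j, ∑ k, |A j k|, ?_⟩
  rintro r ⟨u, hu, rfl⟩
  have h1 : ∀ j, |u j| ≤ 1 := fun j => by
    rw [← sq_le_one_iff_abs_le_one, ← hu]
    exact Finset.single_le_sum (f := fun i => u i ^ 2) (fun i _ => sq_nonneg _)
      (Finset.mem_univ j)
  simp only [dotProduct, Matrix.mulVec, Finset.mul_sum]
  refine Finset.sum_le_sum fun j _ => Finset.sum_le_sum fun k _ => ?_
  refine (le_abs_self _).trans ?_
  rw [abs_mul, abs_mul]
  calc |u j| * (|A j k| * |u k|) ≤ 1 * (|A j k| * 1) := by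
        gcongr
        · exact h1 j
        · exact h1 k
    _ = |A j k| := by ring

theorem dotProduct_mulVec_le_lamMax_mul {m : Type*} [Fintype m] (A : Matrix m m ℝ)
    (z : m → ℝ) : z ⬝ᵥ A.mulVec z ≤ lamMax A * ∑ i, z i ^ 2 := by
  have h0 : 0 ≤ ∑ i, z i ^ 2 := Finset.sum_nonneg fun i _ => sq_nonneg _
  rcases h0.eq_or_lt with h | h
  · have hz : z = 0 := by
      ext i
      have := (Finset.sum_eq_zero_iff_of_nonneg fun i _ => sq_nonneg (z i)).1 h.symm i
        (Finset.mem_univ i)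
      simpa using this
    simp [hz]
  · set c := √(∑ i, z i ^ 2) with hc
    have hc0 : 0 < c := Real.sqrt_pos.2 h
    have hc2 : c ^ 2 = ∑ i, z i ^ 2 := Real.sq_sqrt h0
    have hle : (c⁻¹ • z) ⬝ᵥ A.mulVec (c⁻¹ • z) ≤ lamMax A := by
      refine le_csSup (bddAbove_rayleigh A) ⟨c⁻¹ • z, ?_, rfl⟩
      simp only [Pi.smul_apply, smul_eq_mul, mul_pow, ← Finset.mul_sum, ← hc2]
      field_simp
    rw [Matrix.mulVec_smul, dotProduct_smul, smul_dotProduct, smul_eq_mul, smul_eq_mul] at hle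
    rw [← hc2]
    field_simp at hle
    linarith

theorem lamMax_gramW_le {n p : ℕ} {S : Finset (Fin p)} (hS : S.Nonempty) {w : Fin n → ℝ}
    (hw : ∀ i, 0 ≤ w i) (x : Fin n → Fin p → ℝ) {B : ℝ}
    (h : ∀ u : S → ℝ, ∑ j, u j ^ 2 = 1 → ∃ v : S → ℝ, ∑ j, (u j - v j) ^ 2 ≤ 1 / 4 ∧
      ∑ i, w i * (∑ j : S, x i j * v j) ^ 2 ≤ B) :
    lamMax (gramW S w x) ≤ 4 * B := by
  obtain ⟨j₀, hj₀⟩ := hS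
  have hne : {r : ℝ | ∃ u : S → ℝ, (∑ i, u i ^ 2) = 1 ∧
      r = u ⬝ᵥ (gramW S w x).mulVec u}.Nonempty :=
    ⟨_, Pi.single ⟨j₀, hj₀⟩ 1, by simp [Pi.single_apply], rfl⟩
  have hL0 : 0 ≤ lamMax (gramW S w x) := by
    obtain ⟨r, u, hu, hr⟩ := hne
    have := dotProduct_mulVec_le_lamMax_mul (gramW S w x) u
    rw [hu, mul_one, dotProduct_gramW_mulVec] at this
    exact (Finset.sum_nonneg fun i _ => mul_nonneg (hw i) (sq_nonneg _)).trans this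
  have key : lamMax (gramW S w x) ≤ 2 * B + lamMax (gramW S w x) / 2 := by
    refine csSup_le hne ?_
    rintro r ⟨u, hu, rfl⟩
    obtain ⟨v, huv, hv⟩ := h u hu
    have h1 := dotProduct_mulVec_le_lamMax_mul (gramW S w x) (u - v)
    rw [dotProduct_gramW_mulVec] at h1 ⊢
    have h2 : ∑ i, w i * (∑ j : S, x i j * u j) ^ 2 ≤
        2 * ∑ i, w i * (∑ j : S, x i j * v j) ^ 2 +
          2 * ∑ i, w i * (∑ j : S, x i j * (u - v) j) ^ 2 := by
      rw [Finset.mul_sum, Finset.mul_sum, ← Finset.sum_add_distrib]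
      refine Finset.sum_le_sum fun i _ => ?_
      simp only [Pi.sub_apply, mul_sub, Finset.sum_sub_distrib]
      nlinarith [mul_nonneg (hw i) (sq_nonneg (∑ j : S, x i j * u j -
        2 * ∑ j : S, x i j * v j))]
    have h3 := mul_le_mul_of_nonneg_left huv hL0
    simp only [Pi.sub_apply] at h1 h2
    linarith
  linarith

/-- The multiples of `1 / N` in `[-1, 1]`. -/
noncomputable def unitGrid (N : ℕ) : Finset ℝ :=
  (Finset.Icc (-(N : ℤ)) (N : ℤ)).image fun k : ℤ => (k : ℝ) / N

theorem card_unitGrid_le (N : ℕ) : (unitGrid N).card ≤ 2 * N + 1 := by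
  refine Finset.card_image_le.trans ?_
  rw [Int.card_Icc]
  omega

theorem zero_mem_unitGrid (N : ℕ) : (0 : ℝ) ∈ unitGrid N :=
  Finset.mem_image.2 ⟨0, by simp, by simp⟩

theorem neg_mem_unitGrid {N : ℕ} {r : ℝ} (h : r ∈ unitGrid N) : -r ∈ unitGrid N := by
  obtain ⟨k, hk, rfl⟩ := Finset.mem_image.1 h
  rw [Finset.mem_Icc] at hk
  exact Finset.mem_image.2 ⟨-k, by rw [Finset.mem_Icc]; omega, by push_cast; ring⟩

theorem exists_mem_unitGrid {N : ℕ} (hN : 0 < N) {t : ℝ} (ht : |t| ≤ 1) :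
    ∃ r ∈ unitGrid N, r ^ 2 ≤ t ^ 2 ∧ (t - r) ^ 2 ≤ (1 / N) ^ 2 := by
  have hN' : (0 : ℝ) < N := by exact_mod_cast hN
  wlog h0 : 0 ≤ t generalizing t
  · obtain ⟨r, hr, h1, h2⟩ := this (t := -t) (by rwa [abs_neg]) (by linarith)
    exact ⟨-r, neg_mem_unitGrid hr, by linarith, by nlinarith⟩
  rw [abs_of_nonneg h0] at ht
  have hk0 : 0 ≤ ⌊N * t⌋ := Int.floor_nonneg.2 (by positivity)
  have hk1 := Int.floor_le (N * t)
  have hk2 := Int.lt_floor_add_one (N * t)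
  have hkN : ⌊N * t⌋ ≤ N := by
    have : (⌊N * t⌋ : ℝ) ≤ N := by nlinarith
    exact_mod_cast this
  have hk0' : (0 : ℝ) ≤ ⌊N * t⌋ := by exact_mod_cast hk0
  have hr1 : (⌊N * t⌋ : ℝ) / N ≤ t := by rw [div_le_iff₀ hN']; linarith
  have hr2 : t - (⌊N * t⌋ : ℝ) / N ≤ 1 / N := by
    rw [sub_le_iff_le_add, ← add_div, le_div_iff₀ hN']; linarith
  refine ⟨(⌊N * t⌋ : ℝ) / N, Finset.mem_image.2 ⟨⌊N * t⌋, ?_, rfl⟩, ?_, ?_⟩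
  · rw [Finset.mem_Icc]; omega
  · gcongr
  · have : 0 ≤ t - (⌊N * t⌋ : ℝ) / N := by linarith
    gcongr

/-- Vectors with at most `s` nonzero coordinates, all of them multiples of `1 / (2 s)` in
`[-1, 1]`. -/
noncomputable def sparseGrid (p s : ℕ) : Finset (Fin p → ℝ) :=
  (Finset.univ.powersetCard s).biUnion fun S =>
    Fintype.piFinset fun j => if j ∈ S then unitGrid (2 * s) else {0}

theorem card_sparseGrid_le (p s : ℕ) : (sparseGrid p s).card ≤ p ^ s * (4 * s + 1) ^ s := by
  refine (Finset.card_biUnion_le_card_mul _ _ ((4 * s + 1) ^ s) fun S hS => ?_).trans ?_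
  · rw [Fintype.card_piFinset]
    simp only [apply_ite Finset.card, Finset.card_singleton]
    rw [Finset.prod_ite_mem, Finset.univ_inter, Finset.prod_const, (Finset.mem_powersetCard.1 hS).2]
    refine Nat.pow_le_pow_left ((card_unitGrid_le _).trans (by omega)) _
  · rw [Finset.card_powersetCard, Finset.card_univ, Fintype.card_fin]
    exact Nat.mul_le_mul_right _ (Nat.choose_le_pow p s)

theorem exists_mem_sparseGrid {p s : ℕ} (hs : 1 ≤ s) (hsp : s ≤ p) {S : Finset (Fin p)}
    (hS : S.card ≤ s) {u : S → ℝ} (hu : ∑ j, u j ^ 2 = 1) :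
    ∃ v ∈ sparseGrid p s, (∀ j ∉ S, v j = 0) ∧ ∑ j, v j ^ 2 ≤ 1 ∧
      ∑ j : S, (u j - v j) ^ 2 ≤ 1 / 4 := by
  have h1 : ∀ j, |u j| ≤ 1 := fun j => by
    rw [← sq_le_one_iff_abs_le_one, ← hu]
    exact Finset.single_le_sum (f := fun i => u i ^ 2) (fun i _ => sq_nonneg _)
      (Finset.mem_univ j)
  choose r hr hr1 hr2 using fun j => exists_mem_unitGrid (N := 2 * s) (by omega) (h1 j)
  obtain ⟨T, hST, hT⟩ := Finset.exists_superset_card_eq hS (by simpa using hsp)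
  have hv : ∀ j : S, (if h : (j : Fin p) ∈ S then r ⟨j, h⟩ else 0) = r j := fun j => by simp
  refine ⟨fun j => if h : j ∈ S then r ⟨j, h⟩ else 0, ?_, fun j hj => by simp [hj], ?_, ?_⟩
  · refine Finset.mem_biUnion.2 ⟨T, Finset.mem_powersetCard.2 ⟨Finset.subset_univ _, hT⟩, ?_⟩
    rw [Fintype.mem_piFinset]
    intro j
    by_cases hj : j ∈ S
    · simpa [hj, hST hj] using hr _
    · by_cases hjT : j ∈ T
      · simpa [hj, hjT] using zero_mem_unitGrid (2 * s)
      · simp [hj, hjT]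
  · rw [← Finset.sum_subset (Finset.subset_univ S) (fun j _ hj => by simp [hj]),
      ← Finset.sum_coe_sort S, ← hu]
    exact Finset.sum_le_sum fun j _ => by simpa only [hv] using hr1 j
  · have hs' : (1 : ℝ) ≤ s := by exact_mod_cast hs
    have hS' : (S.card : ℝ) ≤ s := by exact_mod_cast hS
    refine (Finset.sum_le_sum (g := fun _ : S => (1 / ((2 * s : ℕ) : ℝ)) ^ 2)
      fun j _ => by simpa only [hv] using hr2 j).trans ?_
    rw [Finset.sum_const, Finset.card_univ, Fintype.card_coe, nsmul_eq_mul, div_pow,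
      ← mul_div_assoc, div_le_div_iff₀ (by positivity) (by norm_num)]
    push_cast
    nlinarith

theorem sum_mul_sq_le {n : ℕ} {w y : Fin n → ℝ} (hw : ∀ i, 0 ≤ w i) {t a b : ℝ} (ht : 0 < t)
    (hwa : ∑ i, w i ^ 3 ≤ a * t ^ 3) (hyb : ∑ i, |y i| ^ 3 ≤ b) :
    ∑ i, w i * y i ^ 2 ≤ t * (a + b) := by
  have h : ∀ i, w i * y i ^ 2 ≤ t * ((t ^ 3)⁻¹ * w i ^ 3 + |y i| ^ 3) := fun i => by
    obtain ⟨c, hc⟩ : ∃ c, w i = t * c := ⟨w i / t, by field_simp⟩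
    have hc0 : 0 ≤ c := by
      have := hw i
      rw [hc] at this
      exact nonneg_of_mul_nonneg_right this ht
    have hd : 0 ≤ |y i| := abs_nonneg _
    have : c * |y i| ^ 2 ≤ c ^ 3 + |y i| ^ 3 := by
      rcases le_total c |y i| with hle | hle
      · nlinarith [mul_le_mul_of_nonneg_right hle (sq_nonneg |y i|), pow_nonneg hc0 3]
      · nlinarith [mul_le_mul_of_nonneg_left (pow_le_pow_left₀ hd hle 2) hc0, pow_nonneg hd 3]
    rw [hc, ← sq_abs (y i), mul_pow, inv_mul_cancel_left₀ (by positivity), mul_assoc]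
    gcongr
  refine (Finset.sum_le_sum fun i _ => h i).trans ?_
  rw [← Finset.mul_sum, Finset.sum_add_distrib, ← Finset.mul_sum]
  gcongr
  rw [inv_mul_le_iff₀ (by positivity)]
  linarith

theorem gaussMat_map_mulVec (n p : ℕ) (v : Fin p → ℝ) :
    (gaussMat n p).map (fun x i => ∑ j, x i j * v j) =
      Measure.pi fun _ : Fin n => gaussianReal 0 (∑ j, v j ^ 2).toNNReal := by
  rw [← map_dotProduct_pi_gaussianReal, gaussMat]
  have : IsProbabilityMeasure ((Measure.pi fun _ : Fin p => gaussianReal 0 1).map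
      (fun x => ∑ j, x j * v j)) := by
    rw [map_dotProduct_pi_gaussianReal]; infer_instance
  exact Measure.pi_map_pi (f := fun (_ : Fin n) (x : Fin p → ℝ) => ∑ j, x j * v j)
    (fun _ => Measurable.aemeasurable (by fun_prop))

theorem pow_mul_exp_neg_sq_le {s p n : ℕ} {m : ℝ} (hsp : s ≤ p) (hp : 8 ≤ p) (hm : 0 < m)
    (hmn : m ^ 3 = n) (h : 8 * ((s : ℝ) * Real.log p) ^ ((3 : ℝ) / 2) ≤ n) :
    ((p ^ s * (4 * s + 1) ^ s : ℕ) : ℝ) * exp (-m ^ 2) ≤ (p : ℝ) ^ (-(s : ℝ)) := by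
  have hp0 : (0 : ℝ) < p := by exact_mod_cast (by omega : 0 < p)
  have hlog : 0 ≤ Real.log p := Real.log_natCast_nonneg p
  have ha : 0 ≤ (s : ℝ) * Real.log p := by positivity
  have hm2 : 4 * (s * Real.log p) ≤ m ^ 2 := by
    rw [show (3 : ℝ) / 2 = 1 / 2 * (3 : ℕ) by norm_num, Real.rpow_mul_natCast ha,
      ← Real.sqrt_eq_rpow, ← hmn] at h
    have h1 : 2 * √(s * Real.log p) ≤ m :=
      le_of_pow_le_pow_left₀ (n := 3) (by norm_num) hm.le (by nlinarith)
    have h2 := pow_le_pow_left₀ (by positivity) h1 2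
    rw [mul_pow, Real.sq_sqrt ha] at h2
    linarith
  have he : exp (-m ^ 2) ≤ ((p : ℝ) ^ (4 * s))⁻¹ := by
    rw [Real.exp_neg]
    gcongr
    rw [← Real.exp_log (pow_pos hp0 _), Real.log_pow]
    apply Real.exp_le_exp.2
    push_cast
    linarith
  have hc : ((p ^ s * (4 * s + 1) ^ s : ℕ) : ℝ) ≤ (p : ℝ) ^ (3 * s) := by
    have h1 : 4 * s + 1 ≤ p ^ 2 := by nlinarith
    have h2 : p ^ s * (4 * s + 1) ^ s ≤ p ^ (3 * s) := by
      calc p ^ s * (4 * s + 1) ^ s ≤ p ^ s * (p ^ 2) ^ s := by gcongr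
        _ = p ^ (3 * s) := by rw [← pow_mul, ← pow_add]; ring_nf
    exact_mod_cast h2
  rw [Real.rpow_neg hp0.le, Real.rpow_natCast]
  refine (mul_le_mul hc he (exp_pos _).le (by positivity)).trans (le_of_eq ?_)
  rw [show 4 * s = 3 * s + s by ring, pow_add]
  field_simp

theorem lamMax_gramW_exp_lt {n p s : ℕ} (hn : 1 ≤ n) (hs : 1 ≤ s) (hsp : s ≤ p)
    {θ : Fin p → ℝ} {x : Fin n → Fin p → ℝ}
    (hexp : ∑ i, exp (3 * ∑ j, x i j * θ j) ≤ 2 * n * exp (9 * ∑ j, θ j ^ 2))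
    (hcube : ∀ v ∈ sparseGrid p s, ∑ j, v j ^ 2 ≤ 1 →
      ∑ i, |∑ j, x i j * v j| ^ 3 ≤ 288 * n)
    {S : Finset (Fin p)} (hS : S.Nonempty) (hSs : S.card ≤ s) :
    lamMax (gramW S (fun i => exp (∑ j, x i j * θ j)) x) <
      1161 * exp (3 * ∑ j, θ j ^ 2) * n := by
  have hn0 : (0 : ℝ) < n := by exact_mod_cast hn
  have h := lamMax_gramW_le hS (w := fun i => exp (∑ j, x i j * θ j))
    (fun i => (exp_pos _).le) x (B := exp (3 * ∑ j, θ j ^ 2) * (2 * n + 288 * n)) fun u hu => by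
      obtain ⟨v, hv, hv0, hv1, huv⟩ := exists_mem_sparseGrid hs hsp hSs hu
      refine ⟨fun j => v j, huv, ?_⟩
      have hsum : ∀ i, ∑ j : S, x i j * v j = ∑ j, x i j * v j := fun i => by
        rw [← Finset.sum_subset (Finset.subset_univ S) fun j _ hj => by simp [hv0 j hj],
          ← Finset.sum_coe_sort S]
      simp only [hsum]
      refine sum_mul_sq_le (fun i => (exp_pos _).le) (exp_pos _) ?_ (hcube v hv hv1)
      simp only [← Real.exp_nat_mul, ← mul_assoc]
      norm_num
      exact hexp
  refine h.trans_lt ?_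
  have : 0 < exp (3 * ∑ j, θ j ^ 2) * n := by positivity
  linarith

/-- uniform upper bound on `λ_max(V_{n,S})` in Poisson regression. -/
theorem stmt_16 : ∃ C K : ℝ, 0 < C ∧ 0 < K ∧
    ∀ n p sstar : ℕ, 1 ≤ n → 1 ≤ sstar → sstar ≤ p →
      C * ((sstar : ℝ) * Real.log p) ^ ((3 : ℝ) / 2) ≤ (n : ℝ) → C ≤ (p : ℝ) →
      ∀ θ₀ : Fin p → ℝ,
        gaussMat n p {x | ∃ S : Finset (Fin p), S.Nonempty ∧ S.card ≤ sstar ∧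
            K * Real.exp (3 * ∑ j, θ₀ j ^ 2) * (n : ℝ) ≤
              lamMax (gramW S (fun i => Real.exp (∑ j, x i j * θ₀ j)) x)}
          ≤ ENNReal.ofReal (1 / n + Real.exp (-(n : ℝ) / 24) +
              6 * (p : ℝ) ^ (-(sstar : ℝ))) := by
  refine ⟨8, 1161, by norm_num, by norm_num, ?_⟩
  intro n p s hn hs hsp hCn hCp θ
  have hp : 8 ≤ p := by exact_mod_cast hCp
  have hn0 : (0 : ℝ) < n := by exact_mod_cast hn
  obtain ⟨m, hm, hmn⟩ : ∃ m : ℝ, 0 < m ∧ m ^ 3 = n :=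
    ⟨(n : ℝ) ^ ((3 : ℕ)⁻¹ : ℝ), by positivity, Real.rpow_inv_natCast_pow hn0.le (by norm_num)⟩
  let net := (sparseGrid p s).filter fun v => ∑ j, v j ^ 2 ≤ 1
  have hlin : ∀ v : Fin p → ℝ,
      Measurable fun (x : Fin n → Fin p → ℝ) (i : Fin n) => ∑ j, x i j * v j := fun v => by
    fun_prop
  have hexp : gaussMat n p {x | 2 * n * exp (9 * ∑ j, θ j ^ 2) ≤
      ∑ i, exp (3 * ∑ j, x i j * θ j)} ≤ ENNReal.ofReal (1 / n) := by
    have h := measure_le_sum_exp_three_mul hn (∑ j, θ j ^ 2).toNNReal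
    rw [← gaussMat_map_mulVec, Measure.map_apply (hlin θ)
      (measurableSet_le (by fun_prop) (by fun_prop)),
      Real.coe_toNNReal _ (Finset.sum_nonneg fun j _ => sq_nonneg _)] at h
    exact h
  have hcube : ∀ v ∈ net, gaussMat n p {x | 288 * (n : ℝ) ≤ ∑ i, |∑ j, x i j * v j| ^ 3} ≤
      ENNReal.ofReal (3 * exp (-m ^ 2)) := fun v hv => by
    have h := measureReal_le_sum_abs_pow_three (n := n) (s := (∑ j, v j ^ 2).toNNReal)
      (by simpa using (Finset.mem_filter.1 hv).2) hm hmn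
    have h' := ENNReal.ofReal_le_ofReal h
    rw [ofReal_measureReal, ← gaussMat_map_mulVec, Measure.map_apply (hlin v)
      (measurableSet_le (by fun_prop) (by fun_prop))] at h'
    exact h'
  calc _ ≤ gaussMat n p ({x | 2 * n * exp (9 * ∑ j, θ j ^ 2) ≤
          ∑ i, exp (3 * ∑ j, x i j * θ j)} ∪
          ⋃ v ∈ net, {x | 288 * (n : ℝ) ≤ ∑ i, |∑ j, x i j * v j| ^ 3}) := by
        refine measure_mono ?_
        rintro x ⟨S, hS, hSs, hle⟩
        by_contra hx
        simp only [Set.mem_union, Set.mem_iUnion, Set.mem_ofPred_eq, not_or, not_exists,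
          not_le] at hx
        exact hle.not_gt (lamMax_gramW_exp_lt hn hs hsp hx.1.le
          (fun v hv hv1 => (hx.2 v (Finset.mem_filter.2 ⟨hv, hv1⟩)).le) hS hSs)
    _ ≤ ENNReal.ofReal (1 / n) + ∑ v ∈ net, ENNReal.ofReal (3 * exp (-m ^ 2)) :=
        (measure_union_le _ _).trans (add_le_add hexp
          ((measure_biUnion_finset_le _ _).trans (Finset.sum_le_sum hcube)))
    _ = ENNReal.ofReal (1 / n + net.card * (3 * exp (-m ^ 2))) := by
        rw [Finset.sum_const, ENNReal.ofReal_add (by positivity) (by positivity),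
          ENNReal.ofReal_mul (Nat.cast_nonneg net.card), ENNReal.ofReal_natCast, nsmul_eq_mul]
    _ ≤ _ := by
        refine ENNReal.ofReal_le_ofReal ?_
        have hcard : (net.card : ℝ) ≤ ((p ^ s * (4 * s + 1) ^ s : ℕ) : ℝ) := by
          exact_mod_cast (Finset.card_filter_le _ _).trans (card_sparseGrid_le p s)
        have h1 := mul_le_mul_of_nonneg_right hcard (exp_pos (-m ^ 2)).le
        have h2 := pow_mul_exp_neg_sq_le hsp hp hm hmn hCn
        have h3 := exp_pos (-(n : ℝ) / 24)
        have h4 : 0 ≤ (p : ℝ) ^ (-(s : ℝ)) := by positivity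
        linarith
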